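/- arXiv:math/0205172 — 2 statements merged into one kernel-verified Lean document; each statement's English description precedes it below -/
import Mathlib

section
/- Let (X_n) be an expander of degree d and conductance c > 0. Then there is a constant c₀ (which may be taken to depend only on c and d) such that for every n and every nonconstant map f : X_n → ℓ², one has D_f ≤ c₀; equivalently, (1/|P_n|) ∑_{{x,y}∈P_n} ‖f(x)−f(y)‖² ≤ c₀ · (1/|E_n|) ∑_{{x,y}∈E_n} ‖f(x)−f(y)‖², where P_n is the set of unordered pairs of distinct vertices of X_n and E_n its edge set. -/
open Classical in
/-- The degree of a vertex `v` in a finite simple graph. -/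
noncomputable def gdeg {V : Type*} [Fintype V] (G : SimpleGraph V) (v : V) : ℕ :=
  (Finset.univ.filter fun w => G.Adj v w).card

open Classical in
/-- The boundary `∂A = {x : dist(x, A) = 1}` of a set of vertices `A`: the set of
vertices not in `A` that are adjacent to a vertex of `A`. -/
noncomputable def graphBoundary {V : Type*} [Fintype V] (G : SimpleGraph V)
    (A : Finset V) : Finset V :=
  Finset.univ.filter fun x => x ∉ A ∧ ∃ a ∈ A, G.Adj x a

/-- An expander of degree `d` and conductance `c`: a sequence of finite connected
`d`-regular graphs whose cardinalities tend to infinity, such that every set `A`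
of at most half the vertices satisfies `|∂A| ≥ c·|A|`. -/
structure Expander (d : ℕ) (c : ℝ) where
  V : ℕ → Type
  [fintype : ∀ n, Fintype (V n)]
  G : ∀ n, SimpleGraph (V n)
  connected : ∀ n, (G n).Connected
  regular : ∀ (n : ℕ) (v : V n), gdeg (G n) v = d
  card_tendsto : Filter.Tendsto (fun n => Fintype.card (V n)) Filter.atTop Filter.atTop
  expansion : ∀ (n : ℕ) (A : Finset (V n)),
    (A.card : ℝ) ≤ (Fintype.card (V n) : ℝ) / 2 →
    c * A.card ≤ ((graphBoundary (G n) A).card : ℝ)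

attribute [instance] Expander.fintype

open Classical in
/-- The finset of unordered pairs of distinct vertices. -/
noncomputable def offDiagPairs (V : Type*) [Fintype V] : Finset (Sym2 V) :=
  Finset.univ.filter fun e => ¬ e.IsDiag

/-- The squared distance `‖f x − f y‖²` as a function of the unordered pair `{x, y}`. -/
noncomputable def sqDistFun {V H : Type*} [NormedAddCommGroup H] (f : V → H) :
    Sym2 V → ℝ :=
  Sym2.lift ⟨fun x y => ‖f x - f y‖ ^ 2, fun x y => by show ‖f x - f y‖ ^ 2 = ‖f y - f x‖ ^ 2; rw [norm_sub_rev]⟩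

/-- `∑_{{x,y} ∈ P} ‖f x − f y‖²`, summed over unordered pairs of distinct vertices. -/
noncomputable def pairSqSum {V : Type*} [Fintype V] {H : Type*} [NormedAddCommGroup H]
    (f : V → H) : ℝ :=
  ∑ e ∈ offDiagPairs V, sqDistFun f e

open Classical in
/-- `∑_{{x,y} ∈ E} ‖f x − f y‖²`, summed over the edges of `G`. -/
noncomputable def edgeSqSum {V : Type*} [Fintype V] (G : SimpleGraph V)
    {H : Type*} [NormedAddCommGroup H] (f : V → H) : ℝ :=
  ∑ e ∈ G.edgeFinset, sqDistFun f e

open Classical in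
/-- The number of edges of a finite simple graph. -/
noncomputable def edgeCount {V : Type*} [Fintype V] (G : SimpleGraph V) : ℕ :=
  G.edgeFinset.card

open Classical in
theorem aux_median {V : Type*} [Fintype V] [Nonempty V] (g : V → ℝ) :
    ∃ m : ℝ, 2 * (Finset.univ.filter fun x => m < g x).card ≤ Fintype.card V ∧
      2 * (Finset.univ.filter fun x => g x < m).card ≤ Fintype.card V := by
  obtain ⟨z, hz⟩ := Finite.exists_max g
  have hne : (Finset.univ.filter fun x =>
      2 * (Finset.univ.filter fun y => g x < g y).card ≤ Fintype.card V).Nonempty := by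
    refine ⟨z, ?_⟩
    rw [Finset.mem_filter]
    refine ⟨Finset.mem_univ _, ?_⟩
    rw [Finset.filter_false_of_mem (fun y _ => not_lt.mpr (hz y))]
    simp
  obtain ⟨x0, hx0, hmin⟩ := Finset.exists_min_image _ g hne
  rw [Finset.mem_filter] at hx0
  refine ⟨g x0, hx0.2, ?_⟩
  by_cases hE : (Finset.univ.filter fun x => g x < g x0).Nonempty
  · obtain ⟨x1, hx1, hmax⟩ := Finset.exists_max_image _ g hE
    rw [Finset.mem_filter] at hx1
    have h1 : Fintype.card V < 2 * (Finset.univ.filter fun y => g x1 < g y).card := by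
      by_contra hcon
      have := hmin x1 (by rw [Finset.mem_filter]; exact ⟨Finset.mem_univ _, not_lt.mp hcon⟩)
      linarith [hx1.2]
    have h2 : (Finset.univ.filter fun y => g x1 < g y).card +
        (Finset.univ.filter fun x => g x < g x0).card ≤ Fintype.card V := by
      rw [← Finset.card_union_of_disjoint]
      · exact Finset.card_le_univ _
      · rw [Finset.disjoint_left]
        intro a ha hb
        have := hmax a hb
        rw [Finset.mem_filter] at ha
        linarith [ha.2]
    omega
  · rw [Finset.not_nonempty_iff_eq_empty] at hE
    rw [hE]; simp

open Classical in
theorem aux_coarea {V : Type*} [Fintype V] (G : SimpleGraph V) (c : ℝ)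
    (hexp : ∀ A : Finset V, (A.card : ℝ) ≤ (Fintype.card V : ℝ) / 2 →
      c * A.card ≤ ((graphBoundary G A).card : ℝ))
    (u : V → ℝ) (hu : ∀ x, 0 ≤ u x)
    (hs : 2 * (Finset.univ.filter fun x => 0 < u x).card ≤ Fintype.card V) :
    c * ∑ x, u x ≤ ∑ x, ∑ y, if G.Adj x y then max (u x - u y) 0 else 0 := by
  let I : ℝ → ℝ → ℝ → ℝ := fun a b => Set.indicator (Set.Ico a b) (fun _ => (1 : ℝ))
  have hI : ∀ a b, MeasureTheory.Integrable (I a b) := fun a b => by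
    rw [MeasureTheory.integrable_indicator_iff measurableSet_Ico]
    simp
  have hint : ∀ a b, ∫ t, I a b t = max (b - a) 0 := fun a b => by
    simp [I, MeasureTheory.integral_indicator measurableSet_Ico, Real.volume_real_Ico]
  have hpt : ∀ t, c * ∑ x, I 0 (u x) t ≤
      ∑ x, ∑ y, if G.Adj x y then I (u y) (u x) t else 0 := by
    intro t
    have hnn : ∀ a b, 0 ≤ I a b t := fun a b =>
      Set.indicator_nonneg (fun _ _ => zero_le_one) _
    by_cases ht : 0 ≤ t
    · set A : Finset V := Finset.univ.filter fun x => t < u x with hA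
      have hAc : (A.card : ℝ) ≤ (Fintype.card V : ℝ) / 2 := by
        have h1 : A.card ≤ (Finset.univ.filter fun x => 0 < u x).card := by
          apply Finset.card_le_card
          intro x hx
          simp only [hA, Finset.mem_filter, Finset.mem_univ, true_and] at hx ⊢
          linarith
        have h2 : 2 * A.card ≤ Fintype.card V := by omega
        have h3 : (2 : ℝ) * A.card ≤ Fintype.card V := by exact_mod_cast h2
        linarith
      have h1 : ∑ x, I 0 (u x) t = A.card := by
        simp [I, Set.indicator_apply, ht, hA]
      rw [h1]
      refine (hexp A hAc).trans ?_
      rw [Finset.sum_comm]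
      have h2 : ((graphBoundary G A).card : ℝ) = ∑ y, if y ∈ graphBoundary G A then (1 : ℝ) else 0 := by
        simp
      rw [h2]
      apply Finset.sum_le_sum
      intro y _
      split_ifs with hy
      · simp only [graphBoundary, Finset.mem_filter, Finset.mem_univ, true_and] at hy
        obtain ⟨hyA, a, ha, hadj⟩ := hy
        have h3 : (if G.Adj a y then I (u y) (u a) t else 0) = 1 := by
          rw [if_pos hadj.symm]
          simp only [hA, Finset.mem_filter, Finset.mem_univ, true_and, not_lt] at hyA ha
          simp [I, Set.indicator_apply, hyA, ha]
        rw [← h3]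
        apply Finset.single_le_sum (f := fun x => if G.Adj x y then I (u y) (u x) t else 0) _ (Finset.mem_univ a)
        intro x _
        split_ifs
        exacts [hnn _ _, le_rfl]
      · apply Finset.sum_nonneg
        intro x _
        split_ifs
        exacts [hnn _ _, le_rfl]
    · have h1 : ∑ x, I 0 (u x) t = 0 := by
        apply Finset.sum_eq_zero
        intro x _
        simp [I, Set.indicator_apply, ht]
      rw [h1, mul_zero]
      apply Finset.sum_nonneg
      intro x _
      apply Finset.sum_nonneg
      intro y _
      split_ifs
      exacts [hnn _ _, le_rfl]
  have hi2 : ∀ x y, MeasureTheory.Integrable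
      (fun t => if G.Adj x y then I (u y) (u x) t else 0) := by
    intro x y
    split_ifs
    exacts [hI _ _, MeasureTheory.integrable_zero _ _ _]
  have key := MeasureTheory.integral_mono
    ((MeasureTheory.integrable_finsetSum Finset.univ (fun x _ => hI 0 (u x))).const_mul c)
    (MeasureTheory.integrable_finsetSum Finset.univ
      (fun x _ => MeasureTheory.integrable_finsetSum Finset.univ (fun y _ => hi2 x y))) hpt
  rw [MeasureTheory.integral_const_mul,
    MeasureTheory.integral_finsetSum _ (fun x _ => hI 0 (u x)),
    MeasureTheory.integral_finsetSum _
      (fun x _ => MeasureTheory.integrable_finsetSum Finset.univ (fun y _ => hi2 x y))] at key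
  have k1 : ∑ x, ∫ t, I 0 (u x) t = ∑ x, u x := by
    apply Finset.sum_congr rfl
    intro x _
    rw [hint]
    simp [hu x]
  have k2 : ∑ x, ∫ t, ∑ y, (if G.Adj x y then I (u y) (u x) t else 0) =
      ∑ x, ∑ y, if G.Adj x y then max (u x - u y) 0 else 0 := by
    apply Finset.sum_congr rfl
    intro x _
    rw [MeasureTheory.integral_finsetSum _ (fun y _ => hi2 x y)]
    apply Finset.sum_congr rfl
    intro y _
    split_ifs
    · rw [hint]
    · simp
  rw [k1, k2] at key
  exact key

open Classical in
theorem aux_cheeger {V : Type*} [Fintype V] (G : SimpleGraph V) (d : ℕ) (c : ℝ) (hc : 0 < c)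
    (hreg : ∀ v, gdeg G v = d)
    (hexp : ∀ A : Finset V, (A.card : ℝ) ≤ (Fintype.card V : ℝ) / 2 →
      c * A.card ≤ ((graphBoundary G A).card : ℝ))
    (h : V → ℝ) (hh : ∀ x, 0 ≤ h x)
    (hs : 2 * (Finset.univ.filter fun x => 0 < h x).card ≤ Fintype.card V) :
    ∑ x, h x ^ 2 ≤ 4 * (d + 1) / c ^ 2 *
      ∑ x, ∑ y, if G.Adj x y then (h x - h y) ^ 2 else 0 := by
  have h0 := aux_coarea G c hexp (fun x => h x ^ 2) (fun x => sq_nonneg _) (by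
    have : ∀ x, 0 < h x ^ 2 ↔ 0 < h x := fun x =>
      ⟨fun hx => lt_of_le_of_ne (hh x) (by rintro h0; simp [← h0] at hx), fun hx => by positivity⟩
    simpa only [this] using hs)
  have hd1 : ∑ x, ∑ y, (if G.Adj x y then h x ^ 2 else 0) = d * ∑ x, h x ^ 2 := by
    rw [Finset.mul_sum]
    apply Finset.sum_congr rfl
    intro x _
    rw [← Finset.sum_filter, Finset.sum_const, ← hreg x, gdeg, nsmul_eq_mul]
  have hd2 : ∑ x, ∑ y, (if G.Adj x y then h y ^ 2 else 0) = d * ∑ x, h x ^ 2 := by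
    rw [← hd1, Finset.sum_comm]
    simp only [G.adj_comm]
  set L : ℝ := 4 * (d + 1) / c with hL
  have hLpos : 0 < L := by positivity
  have h1 : ∑ x, ∑ y, (if G.Adj x y then max (h x ^ 2 - h y ^ 2) 0 else 0) ≤
      ∑ x, ∑ y, (L / 2 * (if G.Adj x y then (h x - h y) ^ 2 else 0) +
        1 / L * ((if G.Adj x y then h x ^ 2 else 0) + (if G.Adj x y then h y ^ 2 else 0))) := by
    apply Finset.sum_le_sum; intro x _
    apply Finset.sum_le_sum; intro y _
    split_ifs
    · apply max_le
      · have e : L / 2 * (h x - h y) ^ 2 + 1 / L * (h x ^ 2 + h y ^ 2) - (h x ^ 2 - h y ^ 2)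
          = 1 / (2 * L) * ((L * (h x - h y) - (h x + h y)) ^ 2 + (h x - h y) ^ 2) := by
          field_simp; ring
        have : 0 ≤ 1 / (2 * L) * ((L * (h x - h y) - (h x + h y)) ^ 2 + (h x - h y) ^ 2) := by
          positivity
        linarith
      · positivity
    · simp
  simp only [Finset.sum_add_distrib, ← Finset.mul_sum, hd1, hd2] at h1
  set S := ∑ x, ∑ y, if G.Adj x y then (h x - h y) ^ 2 else 0
  set T := ∑ x, h x ^ 2
  have hT : 0 ≤ T := Finset.sum_nonneg fun x _ => sq_nonneg _
  have h2 : c * T ≤ L / 2 * S + 1 / L * (d * T + d * T) := h0.trans h1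
  have h3 : 1 / L * (d * T + d * T) ≤ c / 2 * T := by
    have : c / 2 * T - 1 / L * (d * T + d * T) = c / (2 * (d + 1)) * T := by
      rw [hL]; field_simp; ring
    have : 0 ≤ c / (2 * (d + 1)) * T := by positivity
    linarith
  have h4 : c / 2 * T ≤ L / 2 * S := by linarith
  have h5 : T = 2 / c * (c / 2 * T) := by field_simp
  rw [h5]
  calc _ ≤ 2 / c * (L / 2 * S) := by gcongr
    _ = _ := by rw [hL]; field_simp

open Classical in
theorem aux_scalar {V : Type*} [Fintype V] [Nonempty V] (G : SimpleGraph V) (d : ℕ) (c : ℝ)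
    (hc : 0 < c) (hreg : ∀ v, gdeg G v = d)
    (hexp : ∀ A : Finset V, (A.card : ℝ) ≤ (Fintype.card V : ℝ) / 2 →
      c * A.card ≤ ((graphBoundary G A).card : ℝ))
    (g : V → ℝ) :
    ∑ x, ∑ y, (g x - g y) ^ 2 ≤ 2 * Fintype.card V * (4 * (d + 1) / c ^ 2) *
      ∑ x, ∑ y, if G.Adj x y then (g x - g y) ^ 2 else 0 := by
  obtain ⟨m, hm1, hm2⟩ := aux_median g
  have hp := aux_cheeger G d c hc hreg hexp (fun x => max (g x - m) 0) (fun x => le_max_right _ _)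
    (by simpa using hm1)
  have hn := aux_cheeger G d c hc hreg hexp (fun x => max (m - g x) 0) (fun x => le_max_right _ _)
    (by simpa using hm2)
  have h1 : ∑ x, ∑ y, (g x - g y) ^ 2 ≤ 2 * Fintype.card V * ∑ x, (g x - m) ^ 2 := by
    have e : ∑ x, ∑ y, (g x - g y) ^ 2 =
        2 * Fintype.card V * ∑ x, (g x - m) ^ 2 - 2 * (∑ x, (g x - m)) ^ 2 := by
      have : ∀ x y, (g x - g y) ^ 2 =
        (g x - m) ^ 2 + (g y - m) ^ 2 - 2 * ((g x - m) * (g y - m)) := fun x y => by ring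
      simp only [this, Finset.sum_add_distrib, Finset.sum_sub_distrib, ← Finset.mul_sum,
        ← Finset.sum_mul, Finset.sum_const, Finset.card_univ, nsmul_eq_mul]
      ring
    rw [e]
    linarith [sq_nonneg (∑ x, (g x - m))]
  have h2 : ∑ x, (g x - m) ^ 2 = ∑ x, max (g x - m) 0 ^ 2 + ∑ x, max (m - g x) 0 ^ 2 := by
    rw [← Finset.sum_add_distrib]
    apply Finset.sum_congr rfl
    intro x _
    rcases le_total (g x) m with h | h
    · rw [max_eq_right (by linarith), max_eq_left (by linarith)]; ring
    · rw [max_eq_left (by linarith), max_eq_right (by linarith)]; ring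
  have h3 : (∑ x, ∑ y, if G.Adj x y then (max (g x - m) 0 - max (g y - m) 0) ^ 2 else 0) +
      (∑ x, ∑ y, if G.Adj x y then (max (m - g x) 0 - max (m - g y) 0) ^ 2 else 0) ≤
      ∑ x, ∑ y, if G.Adj x y then (g x - g y) ^ 2 else 0 := by
    simp only [← Finset.sum_add_distrib]
    apply Finset.sum_le_sum; intro x _
    apply Finset.sum_le_sum; intro y _
    split_ifs
    · rcases le_total (g x) m with h | h <;> rcases le_total (g y) m with h' | h'
      · rw [max_eq_right (by linarith : g x - m ≤ 0), max_eq_left (by linarith : 0 ≤ m - g x),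
          max_eq_right (by linarith : g y - m ≤ 0), max_eq_left (by linarith : 0 ≤ m - g y)]
        apply le_of_eq; ring
      · rw [max_eq_right (by linarith : g x - m ≤ 0), max_eq_left (by linarith : 0 ≤ m - g x),
          max_eq_left (by linarith : 0 ≤ g y - m), max_eq_right (by linarith : m - g y ≤ 0)]
        nlinarith [mul_nonneg (sub_nonneg.2 h) (sub_nonneg.2 h')]
      · rw [max_eq_left (by linarith : 0 ≤ g x - m), max_eq_right (by linarith : m - g x ≤ 0),
          max_eq_right (by linarith : g y - m ≤ 0), max_eq_left (by linarith : 0 ≤ m - g y)]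
        nlinarith [mul_nonneg (sub_nonneg.2 h) (sub_nonneg.2 h')]
      · rw [max_eq_left (by linarith : 0 ≤ g x - m), max_eq_right (by linarith : m - g x ≤ 0),
          max_eq_left (by linarith : 0 ≤ g y - m), max_eq_right (by linarith : m - g y ≤ 0)]
        apply le_of_eq; ring
    · simp
  refine h1.trans ?_
  rw [mul_assoc (2 * (Fintype.card V : ℝ))]
  apply mul_le_mul_of_nonneg_left _ (by positivity)
  rw [h2]
  refine (add_le_add hp hn).trans ?_
  rw [← mul_add]
  exact mul_le_mul_of_nonneg_left h3 (by positivity)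

open Classical in
theorem aux_vector {V : Type*} [Fintype V] [Nonempty V] (G : SimpleGraph V) (d : ℕ) (c : ℝ)
    (hc : 0 < c) (hreg : ∀ v, gdeg G v = d)
    (hexp : ∀ A : Finset V, (A.card : ℝ) ≤ (Fintype.card V : ℝ) / 2 →
      c * A.card ≤ ((graphBoundary G A).card : ℝ))
    (f : V → lp (fun _ : ℕ => ℝ) 2) :
    ∑ x, ∑ y, ‖f x - f y‖ ^ 2 ≤ 2 * Fintype.card V * (4 * (d + 1) / c ^ 2) *
      ∑ x, ∑ y, if G.Adj x y then ‖f x - f y‖ ^ 2 else 0 := by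
  have hv : ∀ x y, HasSum (fun i => (f x i - f y i) ^ 2) (‖f x - f y‖ ^ 2) := by
    intro x y
    have := lp.hasSum_norm (p := 2) (by norm_num) (f x - f y)
    simpa using this
  have hv2 : ∀ x y, HasSum (fun i => if G.Adj x y then (f x i - f y i) ^ 2 else 0)
      (if G.Adj x y then ‖f x - f y‖ ^ 2 else 0) := by
    intro x y
    split_ifs
    exacts [hv x y, hasSum_zero]
  exact hasSum_le (fun i => aux_scalar G d c hc hreg hexp (fun x => f x i))
    (hasSum_sum fun x _ => hasSum_sum fun y _ => hv x y)
    ((hasSum_sum fun x _ => hasSum_sum fun y _ => hv2 x y).mul_left _)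

open Classical in
theorem aux_edges {V : Type*} [Fintype V] (G : SimpleGraph V) (F : Sym2 V → ℝ) :
    ∑ x, ∑ y, (if G.Adj x y then F s(x, y) else 0) = 2 * ∑ e ∈ G.edgeFinset, F e := by
  rw [← Fintype.sum_prod_type' (f := fun x y => if G.Adj x y then F s(x, y) else 0)]
  rw [← Finset.sum_filter]
  have hmap : ∀ p ∈ (Finset.univ.filter fun p : V × V => G.Adj p.1 p.2),
      s(p.1, p.2) ∈ G.edgeFinset := by
    intro p hp
    simpa using hp
  rw [← Finset.sum_fiberwise_of_maps_to hmap, Finset.mul_sum]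
  apply Finset.sum_congr rfl
  intro e he
  induction e using Sym2.ind with
  | _ a b =>
    have hab : G.Adj a b := by simpa using he
    have hfil : ((Finset.univ.filter fun p : V × V => G.Adj p.1 p.2).filter
        fun p => s(p.1, p.2) = s(a, b)) = {(a, b), (b, a)} := by
      ext ⟨x, y⟩
      simp only [Finset.mem_filter, Finset.mem_univ, true_and, Finset.mem_insert,
        Finset.mem_singleton, Prod.mk.injEq, Sym2.eq_iff]
      constructor
      · rintro ⟨_, h⟩; exact h
      · rintro (⟨rfl, rfl⟩ | ⟨rfl, rfl⟩)
        exacts [⟨hab, Or.inl ⟨rfl, rfl⟩⟩, ⟨hab.symm, Or.inr ⟨rfl, rfl⟩⟩]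
    rw [hfil, Finset.sum_pair (by intro h; exact hab.ne (Prod.mk.inj h).1)]
    rw [Sym2.eq_swap (a := b)]
    ring

open Classical in
theorem aux_offDiag {V : Type*} [Fintype V] (F : Sym2 V → ℝ) :
    ∑ x, ∑ y, (if x ≠ y then F s(x, y) else 0) = 2 * ∑ e ∈ offDiagPairs V, F e := by
  have h := aux_edges (⊤ : SimpleGraph V) F
  have h2 : offDiagPairs V = (⊤ : SimpleGraph V).edgeFinset := by
    ext e
    simp [offDiagPairs]
  simp only [SimpleGraph.top_adj] at h
  rw [h2]
  convert h

open Classical in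
theorem aux_final {V : Type*} [Fintype V] (G : SimpleGraph V) (d : ℕ) (c : ℝ)
    (hc : 0 < c) (hreg : ∀ v, gdeg G v = d)
    (hexp : ∀ A : Finset V, (A.card : ℝ) ≤ (Fintype.card V : ℝ) / 2 →
      c * A.card ≤ ((graphBoundary G A).card : ℝ))
    (f : V → lp (fun _ : ℕ => ℝ) 2) (hf : ∃ x y, f x ≠ f y) :
    ((offDiagPairs V).card : ℝ)⁻¹ * pairSqSum f ≤
        (8 * (d + 1) / c ^ 2 * d * 2) * (((edgeCount G : ℝ))⁻¹ * edgeSqSum G f) := by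
  obtain ⟨x0, y0, hxy⟩ := hf
  have hne : x0 ≠ y0 := fun h => hxy (by rw [h])
  have : Nonempty V := ⟨x0⟩
  have hN : 2 ≤ Fintype.card V := by
    have : Nontrivial V := ⟨x0, y0, hne⟩
    exact Fintype.one_lt_card
  have hv := aux_vector G d c hc hreg hexp f
  have e1 : ∑ x, ∑ y, (if G.Adj x y then ‖f x - f y‖ ^ 2 else 0) = 2 * edgeSqSum G f :=
    aux_edges G (sqDistFun f)
  have e2 : ∑ x, ∑ y, ‖f x - f y‖ ^ 2 = 2 * pairSqSum f := by
    rw [pairSqSum, ← aux_offDiag]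
    apply Finset.sum_congr rfl; intro x _
    apply Finset.sum_congr rfl; intro y _
    by_cases h : x = y
    · simp [h]
    · simp [h, sqDistFun]
  have e3 : (d : ℝ) * Fintype.card V = 2 * edgeCount G := by
    have := aux_edges G (fun _ => 1)
    simp only [Finset.sum_const, nsmul_eq_mul, mul_one] at this
    rw [edgeCount, ← this]
    have h2 : ∀ x, ∑ y, (if G.Adj x y then (1 : ℝ) else 0) = d := by
      intro x
      rw [← hreg x, gdeg]; simp
    simp [h2, mul_comm]
  have e4 : (Fintype.card V : ℝ) * (Fintype.card V - 1) = 2 * (offDiagPairs V).card := by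
    have := aux_offDiag (V := V) (fun _ => 1)
    simp only [Finset.sum_const, nsmul_eq_mul, mul_one] at this
    rw [← this]
    have h2 : ∀ x : V, ∑ y, (if x ≠ y then (1 : ℝ) else 0)
        = Fintype.card V - 1 := by
      intro x
      have : ∀ y, (if x ≠ y then (1 : ℝ) else 0)
        = 1 - if x = y then 1 else 0 := by
        intro y
        by_cases h : x = y <;> simp [h]
      simp [this]
    rw [Finset.sum_congr rfl (fun x _ => h2 x)]
    simp
    ring
  rw [e1, e2] at hv
  have hN' : (2 : ℝ) ≤ Fintype.card V := by exact_mod_cast hN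
  have hES : 0 ≤ edgeSqSum G f := by
    have : 0 ≤ ∑ x, ∑ y, (if G.Adj x y then ‖f x - f y‖ ^ 2 else 0) :=
      Finset.sum_nonneg fun x _ => Finset.sum_nonneg fun y _ => by split_ifs <;> positivity
    linarith
  set N : ℝ := (Fintype.card V : ℝ)
  have e5 : ((offDiagPairs V).card : ℝ) = N * (N - 1) / 2 := by linarith
  have e6 : (edgeCount G : ℝ) = d * N / 2 := by linarith
  have hN1 : 0 < N - 1 := by linarith
  have hNp : 0 < N := by linarith
  have hv' : pairSqSum f ≤ N * (8 * (d + 1) / c ^ 2) * edgeSqSum G f := by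
    have : 2 * N * (4 * (d + 1) / c ^ 2) * (2 * edgeSqSum G f)
      = 2 * (N * (8 * (d + 1) / c ^ 2) * edgeSqSum G f) := by ring
    linarith
  set K : ℝ := 8 * (d + 1) / c ^ 2
  have hK : 0 ≤ K := by positivity
  rw [e5]
  have step : (N * (N - 1) / 2)⁻¹ * pairSqSum f ≤ 2 * K / (N - 1) * edgeSqSum G f := by
    calc _ ≤ (N * (N - 1) / 2)⁻¹ * (N * K * edgeSqSum G f) := by gcongr
      _ = _ := by field_simp
  refine step.trans ?_
  rcases Nat.eq_zero_or_pos d with hd | hd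
  · have hz : edgeSqSum G f = 0 := by
      have : edgeCount G = 0 := by
        have : (edgeCount G : ℝ) = 0 := by rw [e6, hd]; simp
        exact_mod_cast this
      rw [edgeCount, Finset.card_eq_zero] at this
      rw [edgeSqSum, this, Finset.sum_empty]
    rw [hz]; simp
  · have hd' : (0 : ℝ) < d := by exact_mod_cast hd
    rw [e6]
    have : K * d * 2 * ((d * N / 2)⁻¹ * edgeSqSum G f) = 4 * K / N * edgeSqSum G f := by
      field_simp; ring
    rw [this]
    apply mul_le_mul_of_nonneg_right _ hES
    rw [div_le_div_iff₀ hN1 hNp]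
    nlinarith

/-- Lemma 2 of the paper: for an expander `(X_n)` of degree `d` and conductance
`c > 0` there is a constant `c₀` such that for every `n` and every nonconstant map
`f : X_n → ℓ²` one has
`(1/|P_n|) ∑_{{x,y}∈P_n} ‖f x − f y‖² ≤ c₀ · (1/|E_n|) ∑_{{x,y}∈E_n} ‖f x − f y‖²`,
i.e. `D_f ≤ c₀`. -/
theorem expander_Df_bounded (d : ℕ) (c : ℝ) (hc : 0 < c) (E : Expander d c) :
    ∃ c₀ : ℝ, ∀ (n : ℕ) (f : E.V n → lp (fun _ : ℕ => ℝ) 2),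
      (∃ x y : E.V n, f x ≠ f y) →
      ((offDiagPairs (E.V n)).card : ℝ)⁻¹ * pairSqSum f ≤
        c₀ * (((edgeCount (E.G n) : ℝ))⁻¹ * edgeSqSum (E.G n) f) := by
  exact ⟨_, fun n f hf => aux_final (E.G n) d c hc (E.regular n) (E.expansion n) f hf⟩
end

section
/- Let (X_n) be an expander of degree d and conductance c > 0. Then there is a constant c₀ ≥ 0 such that for every n and every 1-Lipschitz map f : X_n → ℓ² (with respect to the graph metric), (1/|P_n|) ∑_{{x,y}∈P_n} ‖f(x)−f(y)‖² ≤ c₀, where P_n is the set of unordered pairs of distinct vertices of X_n. -/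
section helpers
open Classical Finset

/-- The sum of `F x y` over ordered pairs of adjacent vertices. -/
noncomputable def adjSum {V : Type} [Fintype V] (G : SimpleGraph V) (F : V → V → ℝ) : ℝ :=
  ∑ x, ∑ y, if G.Adj x y then F x y else 0

lemma adjSum_mono {V : Type} [Fintype V] (G : SimpleGraph V) {F F' : V → V → ℝ}
    (h : ∀ x y, G.Adj x y → F x y ≤ F' x y) : adjSum G F ≤ adjSum G F' := by
  unfold adjSum
  refine sum_le_sum fun x _ => sum_le_sum fun y _ => ?_
  split_ifs with hxy
  · exact h x y hxy
  · exact le_rfl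

lemma adjSum_add {V : Type} [Fintype V] (G : SimpleGraph V) (F F' : V → V → ℝ) :
    adjSum G (fun x y => F x y + F' x y) = adjSum G F + adjSum G F' := by
  unfold adjSum
  simp only [← sum_add_distrib]
  refine sum_congr rfl fun x _ => sum_congr rfl fun y _ => ?_
  split_ifs <;> simp

lemma adjSum_mul {V : Type} [Fintype V] (G : SimpleGraph V) (a : ℝ) (F : V → V → ℝ) :
    adjSum G (fun x y => a * F x y) = a * adjSum G F := by
  unfold adjSum
  simp only [mul_sum]
  refine sum_congr rfl fun x _ => sum_congr rfl fun y _ => ?_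
  split_ifs <;> simp

lemma adjSum_left {V : Type} [Fintype V] (G : SimpleGraph V) (d : ℕ)
    (hd : ∀ v, gdeg G v = d) (F : V → ℝ) :
    adjSum G (fun x _ => F x) = d * ∑ x, F x := by
  unfold adjSum
  rw [mul_sum]
  refine sum_congr rfl fun x _ => ?_
  rw [← sum_filter, sum_const, nsmul_eq_mul, ← hd x]
  rfl

lemma adjSum_right {V : Type} [Fintype V] (G : SimpleGraph V) (d : ℕ)
    (hd : ∀ v, gdeg G v = d) (F : V → ℝ) :
    adjSum G (fun _ y => F y) = d * ∑ x, F x := by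
  rw [← adjSum_left G d hd F]
  unfold adjSum
  rw [sum_comm]
  simp only [G.adj_comm]

lemma boundary_le {V : Type} [Fintype V] (G : SimpleGraph V) (A : Finset V) :
    ((graphBoundary G A).card : ℝ) ≤ adjSum G (fun x y => if x ∈ A ∧ y ∉ A then 1 else 0) := by
  unfold adjSum
  rw [sum_comm, card_eq_sum_ones, Nat.cast_sum]
  have h0 : ∀ x y, (0:ℝ) ≤ if G.Adj x y then (if x ∈ A ∧ y ∉ A then (1:ℝ) else 0) else 0 := by
    intro x y; split_ifs <;> norm_num
  refine le_trans (sum_le_sum (g := fun y => ∑ x, if G.Adj x y then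
    (if x ∈ A ∧ y ∉ A then (1:ℝ) else 0) else 0) ?_)
    (sum_le_sum_of_subset_of_nonneg (subset_univ _) fun y _ _ => sum_nonneg fun x _ => h0 x y)
  intro y hy
  obtain ⟨hyA, a, ha, hadj⟩ : y ∉ A ∧ ∃ a ∈ A, G.Adj y a := by
    simpa [graphBoundary] using hy
  refine le_trans ?_ (single_le_sum (fun x _ => h0 x y) (mem_univ a))
  simp [hadj.symm, ha, hyA]

lemma coarea {V : Type} [Fintype V] (G : SimpleGraph V) (c : ℝ)
    (hexp : ∀ A : Finset V, (A.card : ℝ) ≤ (Fintype.card V : ℝ) / 2 →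
      c * A.card ≤ ((graphBoundary G A).card : ℝ)) (k : ℕ) :
    ∀ w : V → ℝ, (∀ x, 0 ≤ w x) → (univ.filter fun x => 0 < w x).card = k →
      (k : ℝ) ≤ (Fintype.card V : ℝ) / 2 →
      c * ∑ x, w x ≤ adjSum G (fun x y => max (w x - w y) 0) := by
  induction k using Nat.strong_induction_on with
  | _ k ih =>
  intro w hw hk hk2
  set A := univ.filter fun x => 0 < w x with hA
  have hmem : ∀ x, x ∈ A ↔ 0 < w x := by simp [hA]
  rcases A.eq_empty_or_nonempty with hem | hne
  · have hz : ∀ x, w x = 0 := by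
      intro x
      have : x ∉ A := by simp [hem]
      rw [hmem] at this
      linarith [hw x]
    simp [hz, adjSum]
  · obtain ⟨a, ha, hmin⟩ := exists_min_image A w hne
    have hapos := (hmem a).1 ha
    set q : V → ℝ := fun x => w x - w a * (if x ∈ A then 1 else 0) with hq
    have hq_nonneg : ∀ x, 0 ≤ q x := by
      intro x
      by_cases hx : x ∈ A
      · simp [hq, hx, hmin x hx]
      · simp [hq, hx, hw x]
    have hlt : (univ.filter fun x => 0 < q x).card < k := by
      rw [← hk]
      apply card_lt_card
      rw [ssubset_iff_of_subset]
      · exact ⟨a, ha, by simp [hq, ha]⟩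
      · intro x hx
        by_contra hxA
        have h1 : 0 < q x := by simpa using hx
        have h2 : ¬ 0 < w x := by rwa [← hmem]
        simp [hq, hxA] at h1
        exact h2 h1
    have h1 := ih _ hlt q hq_nonneg rfl (le_trans (by exact_mod_cast hlt.le) hk2)
    have h2 := (hexp A (by rw [hk]; exact hk2)).trans (boundary_le G A)
    have h3 : ∑ x, w x = ∑ x, q x + w a * A.card := by
      simp [hq, sum_sub_distrib]
      ring
    have h4 : adjSum G (fun x y => max (w x - w y) 0) =
        adjSum G (fun x y => max (q x - q y) 0) +
          w a * adjSum G (fun x y => if x ∈ A ∧ y ∉ A then 1 else 0) := by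
      rw [← adjSum_mul, ← adjSum_add]
      congr 1
      ext x y
      by_cases hx : x ∈ A <;> by_cases hy : y ∈ A
      · simp [hq, hx, hy]
      · have hy_zero : w y = 0 := le_antisymm (by rw [hmem] at hy; linarith) (hw y)
        have := hmin x hx
        simp [hq, hx, hy, hy_zero]
        rw [max_eq_left (hw x), max_eq_left (by linarith)]; ring
      · have hx0 : w x = 0 := le_antisymm (by rw [hmem] at hx; linarith) (hw x)
        have := hmin y hy
        simp [hq, hx, hy, hx0]
        rw [max_eq_right (by linarith [hw y]), max_eq_right (by linarith)]
      · simp [hq, hx, hy]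
    rw [h3, h4]
    nlinarith [mul_le_mul_of_nonneg_left h2 hapos.le]

lemma cheeger {V : Type} [Fintype V] (G : SimpleGraph V) (d : ℕ) (c : ℝ) (hc : 0 < c)
    (hd : ∀ v, gdeg G v = d)
    (hexp : ∀ A : Finset V, (A.card : ℝ) ≤ (Fintype.card V : ℝ) / 2 →
      c * A.card ≤ ((graphBoundary G A).card : ℝ))
    (u : V → ℝ) (hu : ∀ x, 0 ≤ u x)
    (hs : ((univ.filter fun x => 0 < u x).card : ℝ) ≤ (Fintype.card V : ℝ) / 2) :
    c ^ 2 * ∑ x, u x ^ 2 ≤ 4 * (d + 1) * adjSum G (fun x y => (u x - u y) ^ 2) := by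
  have hf : (univ.filter fun x => 0 < u x ^ 2) = univ.filter fun x => 0 < u x := by
    ext x
    simp only [mem_filter, mem_univ, true_and]
    exact ⟨fun h => lt_of_le_of_ne (hu x) (fun h0 => by simp [← h0] at h), fun h => by positivity⟩
  have h1 := coarea G c hexp _ (fun x => u x ^ 2) (fun x => sq_nonneg _) rfl (by rw [hf]; exact hs)
  set t : ℝ := c / (4 * (d + 1)) with ht
  have hdp : (0:ℝ) < 4 * (d + 1) := by positivity
  have htp : 0 < t := by positivity
  have htd : t * (4 * (d + 1)) = c := by rw [ht]; field_simp
  have h2 : adjSum G (fun x y => max (u x ^ 2 - u y ^ 2) 0) ≤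
      adjSum G (fun x y => (1 / (2 * t)) * (u x - u y) ^ 2 + (t * u x ^ 2 + t * u y ^ 2)) := by
    apply adjSum_mono
    intro x y _
    apply max_le
    · have h3 : (1 / (2 * t)) * (u x - u y) ^ 2 + (t * u x ^ 2 + t * u y ^ 2)
          - (u x ^ 2 - u y ^ 2) =
          (1 / (2 * t)) * ((u x - u y) - t * (u x + u y)) ^ 2 + t / 2 * (u x - u y) ^ 2 := by
        field_simp
        ring
      have h4 : 0 ≤ (1 / (2 * t)) * ((u x - u y) - t * (u x + u y)) ^ 2
          + t / 2 * (u x - u y) ^ 2 := by positivity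
      linarith
    · positivity
  rw [adjSum_add, adjSum_add, adjSum_mul, adjSum_left G d hd (fun x => t * u x ^ 2),
    adjSum_right G d hd (fun x => t * u x ^ 2), ← mul_sum] at h2
  set S := ∑ x, u x ^ 2 with hS
  set D := adjSum G (fun x y => (u x - u y) ^ 2) with hD
  have hS0 : 0 ≤ S := sum_nonneg fun x _ => sq_nonneg _
  have h5 := h1.trans h2
  have h6 : d * (t * S) + d * (t * S) ≤ c / 2 * S := by
    rw [← htd]; nlinarith [mul_nonneg htp.le hS0]
  have h7 : c / 2 * S ≤ 1 / (2 * t) * D := by linarith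
  have h8 : 1 / (2 * t) * D = 2 * (d + 1) * D / c := by
    rw [ht]; field_simp; ring
  rw [h8, le_div_iff₀ hc] at h7
  nlinarith

lemma exists_median {V : Type} [Fintype V] [Nonempty V] (g : V → ℝ) :
    ∃ m : ℝ, ((univ.filter fun x => m < g x).card : ℝ) ≤ (Fintype.card V : ℝ) / 2 ∧
      ((univ.filter fun x => g x < m).card : ℝ) ≤ (Fintype.card V : ℝ) / 2 := by
  set B := univ.filter fun v => 2 * (univ.filter fun x => g x < g v).card ≤ Fintype.card V with hB
  have hBne : B.Nonempty := by
    obtain ⟨v, _, hv⟩ := exists_min_image univ g univ_nonempty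
    refine ⟨v, ?_⟩
    have : (univ.filter fun x => g x < g v) = ∅ := by
      ext x; simpa using hv x (mem_univ x)
    simp [hB, this]
  obtain ⟨v, hvB, hv⟩ := exists_max_image B g hBne
  have h1 : 2 * (univ.filter fun x => g x < g v).card ≤ Fintype.card V := by simpa [hB] using hvB
  have h2 : 2 * (univ.filter fun x => g v < g x).card ≤ Fintype.card V := by
    by_contra hcon
    push Not at hcon
    have hne : (univ.filter fun x => g v < g x).Nonempty := by
      rw [← card_pos]; omega
    obtain ⟨u, hu, hmin⟩ := exists_min_image _ g hne
    have hu' : g v < g u := by simpa using hu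
    have hsub : (univ.filter fun x => g x < g u) ⊆ univ.filter fun x => ¬ g v < g x := by
      intro x hx
      have hx' : g x < g u := by simpa using hx
      simp only [mem_filter, mem_univ, true_and]
      intro h
      have := hmin x (by simpa using h)
      linarith
    have h3 := card_le_card hsub
    have h4 := card_filter_add_card_filter_not (s := (univ : Finset V)) (fun x => g v < g x)
    rw [card_univ] at h4
    have huB : u ∈ B := by
      simp only [hB, mem_filter, mem_univ, true_and]; omega
    have := hv u huB
    linarith
  refine ⟨g v, ?_, ?_⟩
  · have : (2:ℝ) * (univ.filter fun x => g v < g x).card ≤ Fintype.card V := by exact_mod_cast h2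
    linarith
  · have : (2:ℝ) * (univ.filter fun x => g x < g v).card ≤ Fintype.card V := by exact_mod_cast h1
    linarith

lemma poincare {V : Type} [Fintype V] [Nonempty V] (G : SimpleGraph V) (d : ℕ) (c : ℝ)
    (hc : 0 < c) (hd : ∀ v, gdeg G v = d)
    (hexp : ∀ A : Finset V, (A.card : ℝ) ≤ (Fintype.card V : ℝ) / 2 →
      c * A.card ≤ ((graphBoundary G A).card : ℝ)) (g : V → ℝ) :
    c ^ 2 * ∑ x, ∑ y, (g x - g y) ^ 2 ≤
      Fintype.card V * (16 * (d + 1)) * adjSum G (fun x y => (g x - g y) ^ 2) := by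
  obtain ⟨m, hm1, hm2⟩ := exists_median g
  have hp := cheeger G d c hc hd hexp (fun x => max (g x - m) 0) (fun x => le_max_right _ _)
    (by simpa using hm1)
  have hn := cheeger G d c hc hd hexp (fun x => max (m - g x) 0) (fun x => le_max_right _ _)
    (by simpa using hm2)
  have hE : adjSum G (fun x y => (max (g x - m) 0 - max (g y - m) 0) ^ 2) +
      adjSum G (fun x y => (max (m - g x) 0 - max (m - g y) 0) ^ 2) ≤
      adjSum G (fun x y => (g x - g y) ^ 2) := by
    rw [← adjSum_add]
    apply adjSum_mono
    intro x y _
    rcases le_total (g x) m with hx | hx <;> rcases le_total (g y) m with hy | hy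
    · rw [max_eq_right (sub_nonpos.2 hx), max_eq_right (sub_nonpos.2 hy),
        max_eq_left (sub_nonneg.2 hx), max_eq_left (sub_nonneg.2 hy)]
      nlinarith
    · rw [max_eq_right (sub_nonpos.2 hx), max_eq_left (sub_nonneg.2 hy),
        max_eq_left (sub_nonneg.2 hx), max_eq_right (sub_nonpos.2 hy)]
      nlinarith [mul_nonneg (sub_nonneg.2 hx) (sub_nonneg.2 hy)]
    · rw [max_eq_left (sub_nonneg.2 hx), max_eq_right (sub_nonpos.2 hy),
        max_eq_right (sub_nonpos.2 hx), max_eq_left (sub_nonneg.2 hy)]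
      nlinarith [mul_nonneg (sub_nonneg.2 hx) (sub_nonneg.2 hy)]
    · rw [max_eq_left (sub_nonneg.2 hx), max_eq_left (sub_nonneg.2 hy),
        max_eq_right (sub_nonpos.2 hx), max_eq_right (sub_nonpos.2 hy)]
      nlinarith
  have hS : ∑ x, (g x - m) ^ 2 =
      ∑ x, (max (g x - m) 0) ^ 2 + ∑ x, (max (m - g x) 0) ^ 2 := by
    rw [← sum_add_distrib]
    refine sum_congr rfl fun x _ => ?_
    rcases le_total (g x) m with hx | hx
    · rw [max_eq_right (sub_nonpos.2 hx), max_eq_left (sub_nonneg.2 hx)]; ring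
    · rw [max_eq_left (sub_nonneg.2 hx), max_eq_right (sub_nonpos.2 hx)]; ring
  have hD : ∑ x, ∑ y, (g x - g y) ^ 2 ≤ 4 * (Fintype.card V * ∑ x, (g x - m) ^ 2) := by
    have : ∑ x, ∑ y, (g x - g y) ^ 2 ≤
        ∑ x, ∑ y, (2 * (g x - m) ^ 2 + 2 * (g y - m) ^ 2) :=
      sum_le_sum fun x _ => sum_le_sum fun y _ => by
        nlinarith [sq_nonneg ((g x - m) + (g y - m))]
    refine this.trans (le_of_eq ?_)
    simp only [sum_add_distrib, sum_const, card_univ, nsmul_eq_mul, ← mul_sum]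
    ring
  have hN : (0:ℝ) ≤ Fintype.card V := Nat.cast_nonneg _
  have hdp : (0:ℝ) ≤ 4 * (d + 1) := by positivity
  have hfin : c ^ 2 * ∑ x, (g x - m) ^ 2 ≤
      4 * (d + 1) * adjSum G (fun x y => (g x - g y) ^ 2) := by
    rw [hS]
    have := mul_le_mul_of_nonneg_left hE hdp
    linarith
  have h1 := mul_le_mul_of_nonneg_left hD (sq_nonneg c)
  have h2 := mul_le_mul_of_nonneg_left hfin hN
  linarith

lemma lp_hasSum (v : lp (fun _ : ℕ => ℝ) 2) : HasSum (fun i => (v i) ^ 2) (‖v‖ ^ 2) := by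
  have h := lp.hasSum_norm (p := 2) (by norm_num) v
  simpa using h

lemma poincare_lp {V : Type} [Fintype V] [Nonempty V] (G : SimpleGraph V) (d : ℕ) (c : ℝ)
    (hc : 0 < c) (hd : ∀ v, gdeg G v = d)
    (hexp : ∀ A : Finset V, (A.card : ℝ) ≤ (Fintype.card V : ℝ) / 2 →
      c * A.card ≤ ((graphBoundary G A).card : ℝ)) (f : V → lp (fun _ : ℕ => ℝ) 2) :
    c ^ 2 * ∑ x, ∑ y, ‖f x - f y‖ ^ 2 ≤
      Fintype.card V * (16 * (d + 1)) * adjSum G (fun x y => ‖f x - f y‖ ^ 2) := by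
  have hxy : ∀ x y, HasSum (fun i => (f x i - f y i) ^ 2) (‖f x - f y‖ ^ 2) := by
    intro x y
    simpa using lp_hasSum (f x - f y)
  have hL : HasSum (fun i => c ^ 2 * ∑ x, ∑ y, (f x i - f y i) ^ 2)
      (c ^ 2 * ∑ x, ∑ y, ‖f x - f y‖ ^ 2) :=
    (hasSum_sum fun x _ => hasSum_sum fun y _ => hxy x y).mul_left _
  have hR : HasSum (fun i => Fintype.card V * (16 * ((d:ℝ) + 1)) *
        adjSum G (fun x y => (f x i - f y i) ^ 2))
      (Fintype.card V * (16 * ((d:ℝ) + 1)) * adjSum G (fun x y => ‖f x - f y‖ ^ 2)) := by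
    refine HasSum.mul_left _ ?_
    unfold adjSum
    refine hasSum_sum fun x _ => hasSum_sum fun y _ => ?_
    split_ifs
    · exact hxy x y
    · exact hasSum_zero
  exact hasSum_le (fun i => poincare G d c hc hd hexp (fun x => f x i)) hL hR

lemma pairSqSum_le {V : Type} [Fintype V] {H : Type*} [NormedAddCommGroup H] (f : V → H) :
    pairSqSum f ≤ ∑ x, ∑ y, ‖f x - f y‖ ^ 2 := by
  have h0 : ∀ e, 0 ≤ sqDistFun f e := by
    intro e
    induction e using Sym2.ind with
    | _ x y => exact sq_nonneg _
  rw [← Fintype.sum_prod_type' (f := fun x y => ‖f x - f y‖ ^ 2)]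
  rw [← sum_fiberwise (univ : Finset (V × V)) (fun p => s(p.1, p.2))]
  unfold pairSqSum
  refine (sum_le_sum_of_subset_of_nonneg (subset_univ _) fun e _ _ => h0 e).trans ?_
  refine sum_le_sum fun e _ => ?_
  induction e using Sym2.ind with
  | _ x y =>
    refine le_trans (le_of_eq rfl) (single_le_sum (f := fun p : V × V => ‖f p.1 - f p.2‖ ^ 2)
      (a := (x, y)) (fun p _ => sq_nonneg _) ?_)
    simp

lemma card_offDiagPairs (V : Type) [Fintype V] :
    (offDiagPairs V).card = (Fintype.card V).choose 2 := by
  rw [← Sym2.card_subtype_not_diag, Fintype.card_subtype]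
  rfl

end helpers

/-- Corollary 1 of the paper: for an expander `(X_n)` of degree `d` and conductance
`c > 0` there is a constant `c₀ ≥ 0` such that for every `n` and every map
`f : X_n → ℓ²` that is `1`-Lipschitz with respect to the graph metric,
`(1/|P_n|) ∑_{{x,y}∈P_n} ‖f x − f y‖² ≤ c₀`. -/
theorem expander_pairSqSum_bounded (d : ℕ) (c : ℝ) (hc : 0 < c) (E : Expander d c) :
    ∃ c₀ : ℝ, 0 ≤ c₀ ∧ ∀ (n : ℕ) (f : E.V n → lp (fun _ : ℕ => ℝ) 2),
      (∀ x y : E.V n, ‖f x - f y‖ ≤ ((E.G n).dist x y : ℝ)) →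
      ((offDiagPairs (E.V n)).card : ℝ)⁻¹ * pairSqSum f ≤ c₀ := by
  refine ⟨64 * (d + 1) * d / c ^ 2, by positivity, fun n f hf => ?_⟩
  have : Nonempty (E.V n) := (E.connected n).nonempty
  have h1 := poincare_lp (E.G n) d c hc (E.regular n) (E.expansion n) f
  have h2 : adjSum (E.G n) (fun x y => ‖f x - f y‖ ^ 2) ≤ d * Fintype.card (E.V n) := by
    have h := adjSum_left (E.G n) d (E.regular n) (fun _ => 1)
    simp only [Finset.sum_const, Finset.card_univ, nsmul_eq_mul, mul_one] at h
    rw [← h]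
    apply adjSum_mono
    intro x y hxy
    have h3 := hf x y
    rw [SimpleGraph.dist_eq_one_iff_adj.2 hxy] at h3
    have h4 := norm_nonneg (f x - f y)
    push_cast at h3
    nlinarith
  have h5 := pairSqSum_le f
  rw [card_offDiagPairs]
  set N := Fintype.card (E.V n) with hN
  rcases Nat.lt_or_ge N 2 with hlt | hge
  · rw [Nat.choose_eq_zero_of_lt hlt]
    simp only [Nat.cast_zero, inv_zero, zero_mul]
    positivity
  · have hN2 : (2:ℝ) ≤ N := by exact_mod_cast hge
    have hch : ((N.choose 2 : ℕ) : ℝ) = N * (N - 1) / 2 := Nat.cast_choose_two ℝ N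
    have hpos : (0:ℝ) < N * (N - 1) / 2 := by
      have : (0:ℝ) < N - 1 := by linarith
      positivity
    rw [hch, inv_mul_le_iff₀ hpos]
    have hK : (0:ℝ) ≤ N * (16 * (d + 1)) := by positivity
    have h6 : c ^ 2 * pairSqSum f ≤ N * (16 * (d + 1)) * (d * N) :=
      (mul_le_mul_of_nonneg_left h5 (sq_nonneg c)).trans
        (h1.trans (mul_le_mul_of_nonneg_left h2 hK))
    have h7 : (N:ℝ) * N ≤ 4 * (N * (N - 1) / 2) := by nlinarith
    have h8 : (0:ℝ) ≤ 16 * (d + 1) * d := by positivity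
    have h9 := mul_le_mul_of_nonneg_left h7 h8
    rw [mul_div_assoc', le_div_iff₀ (by positivity)]
    linarith
end
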